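/- arXiv:1912.12908 — 4 statements merged into one kernel-verified Lean document; each statement's English description precedes it below -/
import Mathlib

section
/- In any atomless congestion game with exactly two paths (𝒫 = {a, b}), every admissible randomized strategy Nash equilibrium is a randomized strategy robust perfect equilibrium. -/
open MeasureTheory Filter Topology

section RobustPerfect

variable {I : Type*} [MeasurableSpace I] {A : Type*} [Fintype A]

/-- The societal summary of a randomized strategy profile. -/
noncomputable def socSum (lam : Measure I) (h : I → A → ℝ) : A → ℝ :=
  fun a => ∫ i, h i a ∂lam

/-- `h` is a randomized strategy profile: a measurable map into the simplex. -/
def IsProfile (lam : Measure I) (h : I → A → ℝ) : Prop :=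
  Measurable h ∧ ∀ i, h i ∈ stdSimplex ℝ A

/-- A large game: payoffs continuous on the simplex and measurable in the player. -/
def IsLargeGame (u : I → A → (A → ℝ) → ℝ) : Prop :=
  (∀ i a, ContinuousOn (u i a) (stdSimplex ℝ A)) ∧
  (∀ (a : A) (τ : A → ℝ), τ ∈ stdSimplex ℝ A → Measurable fun i => u i a τ)

/-- An atomless measure. -/
def MeasAtomless (lam : Measure I) : Prop :=
  ∀ s : Set I, MeasurableSet s → 0 < lam s →
    ∃ t : Set I, MeasurableSet t ∧ t ⊆ s ∧ 0 < lam t ∧ lam t < lam s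

/-- A Borel probability measure concentrated on the simplex with full support on it. -/
def FullSupportOnSimplex (η : Measure (A → ℝ)) : Prop :=
  IsProbabilityMeasure η ∧ η (stdSimplex ℝ A)ᶜ = 0 ∧
    ∀ U : Set (A → ℝ), IsOpen U → (U ∩ stdSimplex ℝ A).Nonempty → 0 < η U

/-- A perturbation function: a Borel measurable map from the simplex to the
full-support Borel probability measures on the simplex. -/
def IsPerturbation (φ : (A → ℝ) → Measure (A → ℝ)) : Prop :=
  (∀ τ ∈ stdSimplex ℝ A, FullSupportOnSimplex (φ τ)) ∧
  ∀ f : (A → ℝ) → ℝ, Continuous f → Measurable fun τ => ∫ x, f x ∂(φ τ)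

/-- Expected payoff of action `a` against a distribution over societal summaries. -/
noncomputable def payM (ui : A → (A → ℝ) → ℝ) (a : A) (ν : Measure (A → ℝ)) : ℝ :=
  ∫ τ, ui a τ ∂ν

/-- Randomized strategy Nash equilibrium. -/
def IsNash (lam : Measure I) (u : I → A → (A → ℝ) → ℝ) (h : I → A → ℝ) : Prop :=
  IsProfile lam h ∧
  ∀ᵐ i ∂lam, ∀ μ ∈ stdSimplex ℝ A,
    ∑ a, μ a * u i a (socSum lam h) ≤ ∑ a, h i a * u i a (socSum lam h)

/-- A weakly dominated action. -/
def WeaklyDominated (ui : A → (A → ℝ) → ℝ) (a : A) : Prop :=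
  ∃ μ ∈ stdSimplex ℝ A,
    (∀ τ ∈ stdSimplex ℝ A, ui a τ ≤ ∑ b, μ b * ui b τ) ∧
    (∃ τ ∈ stdSimplex ℝ A, ui a τ < ∑ b, μ b * ui b τ)

/-- Admissibility: almost no player puts weight on a weakly dominated action. -/
def Admissible (lam : Measure I) (u : I → A → (A → ℝ) → ℝ) (h : I → A → ℝ) : Prop :=
  ∀ᵐ i ∂lam, ∀ a : A, WeaklyDominated (u i) a → h i a = 0

/-- Weak convergence of a sequence of measures to a Dirac measure. -/
def WeakTendstoDirac (ν : ℕ → Measure (A → ℝ)) (τ : A → ℝ) : Prop :=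
  ∀ f : (A → ℝ) → ℝ, Continuous f →
    Tendsto (fun n => ∫ x, f x ∂(ν n)) atTop (nhds (f τ))

/-- Aggregate robustness. -/
def AggregateRobust (lam : Measure I) (u : I → A → (A → ℝ) → ℝ) (h : I → A → ℝ) : Prop :=
  ∀ᵐ i ∂lam, ∃ φ : ℕ → (A → ℝ) → Measure (A → ℝ),
    (∀ n, IsPerturbation (φ n)) ∧
    (∀ τ ∈ stdSimplex ℝ A, WeakTendstoDirac (fun n => φ n τ) τ) ∧
    ∀ n, ∀ μ ∈ stdSimplex ℝ A,
      ∑ a, μ a * payM (u i) a (φ n (socSum lam h)) ≤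
        ∑ a, h i a * payM (u i) a (φ n (socSum lam h))

/-- `ε`-robust perfect equilibrium with perturbed player space `Iε` and
perturbation function `φ`. -/
def IsEpsRPE (lam : Measure I) (u : I → A → (A → ℝ) → ℝ) (ε : ℝ)
    (h : I → A → ℝ) (Iε : Set I) (φ : (A → ℝ) → Measure (A → ℝ)) : Prop :=
  IsProfile lam h ∧
  (∀ᵐ i ∂lam, ∀ a : A, 0 < h i a) ∧
  MeasurableSet Iε ∧ ENNReal.ofReal (1 - ε) < lam Iε ∧
  IsPerturbation φ ∧
  (∀ τ ∈ stdSimplex ℝ A, ENNReal.ofReal (1 - ε) ≤ φ τ {τ}) ∧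
  ∀ i ∈ Iε, ∀ am al : A,
    payM (u i) am (φ (socSum lam h)) < payM (u i) al (φ (socSum lam h)) →
      h i am ≤ ε

/-- Robust perfect equilibrium. -/
def IsRPE (lam : Measure I) (u : I → A → (A → ℝ) → ℝ) (h : I → A → ℝ) : Prop :=
  IsProfile lam h ∧
  ∃ (ε : ℕ → ℝ) (hs : ℕ → I → A → ℝ) (Is : ℕ → Set I)
      (φs : ℕ → (A → ℝ) → Measure (A → ℝ)),
    (∀ n, 0 < ε n) ∧ Tendsto ε atTop (nhds 0) ∧
    (∀ n, IsEpsRPE lam u (ε n) (hs n) (Is n) (φs n)) ∧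
    (∀ᵐ i ∂lam, ∃ nk : ℕ → ℕ, StrictMono nk ∧ (∀ k, i ∈ Is (nk k)) ∧
      Tendsto (fun k => hs (nk k) i) atTop (nhds (h i))) ∧
    Tendsto (fun n => socSum lam (hs n)) atTop (nhds (socSum lam h))

/-- The Dirac randomized strategy profile induced by a pure strategy profile. -/
def diracProfile [DecidableEq A] (f : I → A) : I → A → ℝ :=
  fun i a => if a = f i then 1 else 0

end RobustPerfect

section Congestion

variable {E P : Type*} [Fintype E] [Fintype P] [DecidableEq E]

/-- The load of edge `e` under the path-flow `τ`. -/
def edgeLoad (edgeOf : P → Finset E) (τ : P → ℝ) (e : E) : ℝ :=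
  ∑ p : P, if e ∈ edgeOf p then τ p else 0

/-- The cost of path `p` under the path-flow `τ`. -/
def pathCost (edgeOf : P → Finset E) (C : E → ℝ → ℝ) (p : P) (τ : P → ℝ) : ℝ :=
  ∑ e ∈ edgeOf p, C e (edgeLoad edgeOf τ e)

/-- Nonnegative, continuous and monotone increasing edge cost functions on `[0,1]`. -/
def IsCongestionCost (C : E → ℝ → ℝ) : Prop :=
  ∀ e, ContinuousOn (C e) (Set.Icc (0:ℝ) 1) ∧ MonotoneOn (C e) (Set.Icc (0:ℝ) 1) ∧
    ∀ x ∈ Set.Icc (0:ℝ) 1, 0 ≤ C e x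

/-- The common payoff of the congestion game: the negative of the path cost. -/
def congPayoff (I : Type*) (edgeOf : P → Finset E) (C : E → ℝ → ℝ) :
    I → P → (P → ℝ) → ℝ :=
  fun _ p τ => -(pathCost edgeOf C p τ)

/-- The uniform distribution on the simplex: the normalized
`(card P - 1)`-dimensional Hausdorff measure restricted to the simplex. -/
noncomputable def unifSimplex (P : Type*) [Fintype P] : Measure (P → ℝ) :=
  (μH[(Fintype.card P : ℝ) - 1] (stdSimplex ℝ P))⁻¹ •
    (μH[(Fintype.card P : ℝ) - 1]).restrict (stdSimplex ℝ P)

/-- The perturbation function `τ ↦ (1-ε)δ_τ + ε η`. -/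
noncomputable def pertOf {A : Type*} [Fintype A] (ε : ℝ) (η : Measure (A → ℝ)) :
    (A → ℝ) → Measure (A → ℝ) :=
  fun τ => ENNReal.ofReal (1 - ε) • Measure.dirac τ + ENNReal.ofReal ε • η

end Congestion

section FullSupport

variable {A : Type*} [Fintype A] {η : Measure (A → ℝ)} {f : (A → ℝ) → ℝ}

theorem FullSupportOnSimplex.ae_mem (hη : FullSupportOnSimplex η) :
    ∀ᵐ τ ∂η, τ ∈ stdSimplex ℝ A :=
  mem_ae_iff.2 hη.2.1

theorem FullSupportOnSimplex.integrable (hη : FullSupportOnSimplex η)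
    (hf : ContinuousOn f (stdSimplex ℝ A)) : Integrable f η := by
  have := hη.1
  have hint : IntegrableOn f (stdSimplex ℝ A) η :=
    hf.integrableOn_compact (isCompact_stdSimplex ℝ A)
  rwa [IntegrableOn, Measure.restrict_eq_self_of_ae_mem hη.ae_mem] at hint

theorem FullSupportOnSimplex.payM_le (hη : FullSupportOnSimplex η) {v : A → (A → ℝ) → ℝ}
    (hv : ∀ c, ContinuousOn (v c) (stdSimplex ℝ A)) {a b : A}
    (hab : ∀ τ ∈ stdSimplex ℝ A, v a τ ≤ v b τ) : payM v a η ≤ payM v b η :=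
  integral_mono_ae (hη.integrable (hv a)) (hη.integrable (hv b)) (hη.ae_mem.mono hab)

theorem FullSupportOnSimplex.integral_pertOf (hη : FullSupportOnSimplex η)
    (hf : ContinuousOn f (stdSimplex ℝ A)) {ε : ℝ} (h0 : 0 ≤ ε) (h1 : ε ≤ 1) (τ : A → ℝ) :
    ∫ x, f x ∂(pertOf ε η τ) = (1 - ε) * f τ + ε * ∫ x, f x ∂η := by
  have hd : Integrable f (Measure.dirac τ) := integrable_dirac (by simp)
  rw [pertOf, integral_add_measure (hd.smul_measure ENNReal.ofReal_ne_top)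
    ((hη.integrable hf).smul_measure ENNReal.ofReal_ne_top), integral_smul_measure,
    integral_smul_measure, integral_dirac, ENNReal.toReal_ofReal (by linarith),
    ENNReal.toReal_ofReal h0, smul_eq_mul, smul_eq_mul]

theorem FullSupportOnSimplex.pertOf (hη : FullSupportOnSimplex η) {ε : ℝ} (h0 : 0 < ε)
    (h1 : ε ≤ 1) {τ : A → ℝ} (hτ : τ ∈ stdSimplex ℝ A) :
    FullSupportOnSimplex (pertOf ε η τ) := by
  have := hη.1
  refine ⟨⟨?_⟩, ?_, fun U hU hne => ?_⟩
  · simp [_root_.pertOf, ← ENNReal.ofReal_add (sub_nonneg.2 h1) h0.le]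
  · simp [_root_.pertOf, hη.2.1, hτ,
      Measure.dirac_apply' τ (isClosed_stdSimplex ℝ A).measurableSet.compl]
  · have hpos := ENNReal.mul_pos (ENNReal.ofReal_pos.2 h0).ne' (hη.2.2 U hU hne).ne'
    simp only [_root_.pertOf, Measure.add_apply, Measure.smul_apply, smul_eq_mul]
    exact hpos.trans_le le_add_self

theorem FullSupportOnSimplex.isPerturbation_pertOf (hη : FullSupportOnSimplex η) {ε : ℝ}
    (h0 : 0 < ε) (h1 : ε ≤ 1) : IsPerturbation (_root_.pertOf ε η) := by
  refine ⟨fun τ hτ => hη.pertOf h0 h1 hτ, fun f hf => ?_⟩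
  simp only [hη.integral_pertOf hf.continuousOn h0.le h1]
  exact (hf.measurable.const_mul _).add_const _

theorem ofReal_le_pertOf_singleton (ε : ℝ) (η : Measure (A → ℝ)) (τ : A → ℝ) :
    ENNReal.ofReal (1 - ε) ≤ pertOf ε η τ {τ} := by
  simp [pertOf]

theorem exists_fullSupportOnSimplex [Nonempty A] :
    ∃ η : Measure (A → ℝ), FullSupportOnSimplex η := by
  classical
  obtain ⟨a⟩ := ‹Nonempty A›
  have : Nonempty (stdSimplex ℝ A) := ⟨⟨_, single_mem_stdSimplex ℝ a⟩⟩
  let x := TopologicalSpace.denseSeq (stdSimplex ℝ A)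
  refine ⟨Measure.sum fun n : ℕ => (2 : ENNReal)⁻¹ ^ (n + 1) • Measure.dirac (x n).1,
    ⟨?_⟩, ?_, ?_⟩
  · rw [Measure.sum_apply _ MeasurableSet.univ]
    simp only [Measure.smul_apply, measure_univ, smul_eq_mul, mul_one]
    rw [ENNReal.tsum_geometric_add_one, ENNReal.one_sub_inv_two, inv_inv]
    exact ENNReal.inv_mul_cancel (by simp) (by simp)
  · have hm := (isClosed_stdSimplex ℝ A).measurableSet.compl
    rw [Measure.sum_apply _ hm]
    simp only [Measure.smul_apply, Measure.dirac_apply' _ hm]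
    simp [fun n => (x n).2]
  · rintro U hU ⟨τ, hτU, hτ⟩
    obtain ⟨n, hn⟩ := (TopologicalSpace.denseRange_denseSeq (stdSimplex ℝ A)).exists_mem_open
      (hU.preimage continuous_subtype_val) ⟨⟨τ, hτ⟩, hτU⟩
    refine lt_of_lt_of_le ?_ (Measure.le_sum_apply _ U)
    refine lt_of_lt_of_le ?_ (ENNReal.le_tsum n)
    have hxU : (x n).1 ∈ U := hn
    rw [Measure.smul_apply, Measure.dirac_apply_of_mem hxU, smul_eq_mul, mul_one]
    exact ENNReal.pow_pos (by simp) _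

/-- A continuous function taking both signs on the simplex integrates to zero against some
full-support distribution. -/
theorem exists_fullSupportOnSimplex_integral_eq_zero (hf : ContinuousOn f (stdSimplex ℝ A))
    {x y : A → ℝ} (hx : x ∈ stdSimplex ℝ A) (hy : y ∈ stdSimplex ℝ A)
    (hfx : f x < 0) (hfy : 0 < f y) :
    ∃ η : Measure (A → ℝ), FullSupportOnSimplex η ∧ ∫ τ, f τ ∂η = 0 := by
  have : Nonempty A := by
    by_contra hA
    rw [not_nonempty_iff] at hA
    exact (hfx.trans hfy).ne (congrArg f (Subsingleton.elim x y))
  obtain ⟨η, hη⟩ := exists_fullSupportOnSimplex (A := A)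
  have balance : ∀ z ∈ stdSimplex ℝ A, f z * ∫ τ, f τ ∂η < 0 →
      ∃ η : Measure (A → ℝ), FullSupportOnSimplex η ∧ ∫ τ, f τ ∂η = 0 := by
    intro z hz hneg
    set m := ∫ τ, f τ ∂η
    have hne : f z - m ≠ 0 := fun h => by
      rw [sub_eq_zero.1 h] at hneg
      exact hneg.not_ge (mul_self_nonneg m)
    have hsq : 0 < (f z - m) ^ 2 := by positivity
    have hw : f z / (f z - m) = f z * (f z - m) / (f z - m) ^ 2 := by field_simp
    have h0 : 0 < f z / (f z - m) := by
      rw [hw]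
      exact div_pos (by nlinarith [mul_self_nonneg (f z)]) hsq
    have h1 : f z / (f z - m) ≤ 1 := by
      rw [hw, div_le_one hsq]
      nlinarith [mul_self_nonneg m]
    refine ⟨_, hη.pertOf h0 h1 hz, ?_⟩
    rw [hη.integral_pertOf hf h0.le h1]
    change (1 - f z / (f z - m)) * f z + f z / (f z - m) * m = 0
    field_simp
    ring
  rcases lt_trichotomy (∫ τ, f τ ∂η) 0 with hm | hm | hm
  · exact balance y hy (mul_neg_of_pos_of_neg hfy hm)
  · exact ⟨η, hη, hm⟩
  · exact balance x hx (mul_neg_of_neg_of_pos hfx hm)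

end FullSupport

section CommonPayoff

variable {I : Type*} [MeasurableSpace I] {A : Type*} [Fintype A]
  {lam : Measure I} {h : I → A → ℝ}

theorem IsProfile.mix (hh : IsProfile lam h) {ε : ℝ} (h0 : 0 ≤ ε) (h1 : ε ≤ 1) {q : A → ℝ}
    (hq : q ∈ stdSimplex ℝ A) : IsProfile lam (fun i => (1 - ε) • h i + ε • q) :=
  ⟨(hh.1.const_smul (1 - ε)).add_const (ε • q), fun i =>
    convex_stdSimplex ℝ A (hh.2 i) hq (sub_nonneg.2 h1) h0 (by ring)⟩

variable [IsProbabilityMeasure lam]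

theorem IsProfile.integrable (hh : IsProfile lam h) (a : A) :
    Integrable (fun i => h i a) lam := by
  refine Integrable.of_bound ((measurable_pi_apply a).comp hh.1).aestronglyMeasurable 1
    (Eventually.of_forall fun i => ?_)
  rw [Real.norm_eq_abs, abs_of_nonneg ((hh.2 i).1 a)]
  exact (mem_Icc_of_mem_stdSimplex (hh.2 i) a).2

theorem IsProfile.socSum_mem (hh : IsProfile lam h) : socSum lam h ∈ stdSimplex ℝ A := by
  refine ⟨fun a => integral_nonneg fun i => (hh.2 i).1 a, ?_⟩
  simp only [socSum]
  rw [← integral_finsetSum _ fun a _ => hh.integrable a]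
  simp [(hh.2 _).2]

theorem IsProfile.socSum_mix (hh : IsProfile lam h) (ε : ℝ) (q : A → ℝ) :
    socSum lam (fun i => (1 - ε) • h i + ε • q) = (1 - ε) • socSum lam h + ε • q := by
  funext a
  simp only [socSum, Pi.add_apply, Pi.smul_apply, smul_eq_mul]
  rw [integral_add ((hh.integrable a).const_mul _) (integrable_const _), integral_const_mul]
  simp

/-- A profile is robust perfect as soon as, after mixing it with a fixed interior strategy and
perturbing the summary towards a fixed full-support distribution, almost every player puts no
weight on the inferior actions. -/
theorem isRPE_of_mix (hh : IsProfile lam h) (v : A → (A → ℝ) → ℝ) {η : Measure (A → ℝ)}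
    (hη : FullSupportOnSimplex η) {q : A → ℝ} (hq : q ∈ stdSimplex ℝ A) (hqpos : ∀ a, 0 < q a)
    (hopt : ∀ ε : ℝ, 0 < ε → ε < 1 → ∀ am al : A,
      payM v am (pertOf ε η ((1 - ε) • socSum lam h + ε • q)) <
        payM v al (pertOf ε η ((1 - ε) • socSum lam h + ε • q)) →
      ∀ᵐ i ∂lam, h i am = 0) :
    IsRPE lam (fun _ => v) h := by
  let ε : ℕ → ℝ := fun n => 1 / ((n : ℝ) + 2)
  have hε0 : ∀ n, 0 < ε n := fun n => by positivity
  have hε1 : ∀ n, ε n < 1 := fun n => by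
    rw [div_lt_one (by positivity)]
    linarith [(Nat.cast_nonneg n : (0 : ℝ) ≤ n)]
  have hεlim : Tendsto ε atTop (𝓝 0) :=
    (tendsto_atTop_add_const_right _ 2 tendsto_natCast_atTop_atTop).const_div_atTop 1
  have hlim : ∀ p : A → ℝ, Tendsto (fun n => (1 - ε n) • p + ε n • q) atTop (𝓝 p) := fun p => by
    simpa using (((tendsto_const_nhds (x := (1 : ℝ))).sub hεlim).smul_const p).add (hεlim.smul_const q)
  let J : ℕ → Set I := fun n => {i | ∀ am al : A,
    payM v am (pertOf (ε n) η ((1 - ε n) • socSum lam h + ε n • q)) <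
      payM v al (pertOf (ε n) η ((1 - ε n) • socSum lam h + ε n • q)) → h i am = 0}
  have hJae : ∀ n, ∀ᵐ i ∂lam, i ∈ J n := fun n => by
    refine ae_all_iff.2 fun am => ae_all_iff.2 fun al => ?_
    by_cases hlt : payM v am (pertOf (ε n) η ((1 - ε n) • socSum lam h + ε n • q)) <
      payM v al (pertOf (ε n) η ((1 - ε n) • socSum lam h + ε n • q))
    · exact (hopt (ε n) (hε0 n) (hε1 n) am al hlt).mono fun i hi _ => hi
    · exact Eventually.of_forall fun i hi => absurd hi hlt
  have hJmeas : ∀ n, MeasurableSet (J n) := fun n => by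
    simp only [J, Set.ofPred_forall]
    exact MeasurableSet.iInter fun am => MeasurableSet.iInter fun al => MeasurableSet.iInter
      fun _ => measurableSet_eq_fun ((measurable_pi_apply am).comp hh.1) measurable_const
  refine ⟨hh, ε, fun n i => (1 - ε n) • h i + ε n • q, J, fun n => pertOf (ε n) η, hε0, hεlim,
    fun n => ?_, ?_, ?_⟩
  · refine ⟨hh.mix (hε0 n).le (hε1 n).le hq, Eventually.of_forall fun i a => ?_, hJmeas n, ?_,
      hη.isPerturbation_pertOf (hε0 n) (hε1 n).le,
      fun τ _ => ofReal_le_pertOf_singleton (ε n) η τ, fun i hi am al hlt => ?_⟩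
    · exact add_pos_of_nonneg_of_pos (mul_nonneg (sub_nonneg.2 (hε1 n).le) ((hh.2 i).1 a))
        (mul_pos (hε0 n) (hqpos a))
    · rw [(prob_compl_eq_zero_iff (hJmeas n)).1 (mem_ae_iff.1 (hJae n)), ENNReal.ofReal_lt_one]
      linarith [hε0 n]
    · rw [hh.socSum_mix] at hlt
      have hzero : h i am = 0 := hi am al hlt
      simp only [Pi.add_apply, Pi.smul_apply, smul_eq_mul, hzero, mul_zero, zero_add]
      exact mul_le_of_le_one_right (hε0 n).le (mem_Icc_of_mem_stdSimplex hq am).2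
  · filter_upwards [ae_all_iff.2 hJae] with i hi
    exact ⟨id, strictMono_id, hi, hlim (h i)⟩
  · simp only [hh.socSum_mix]
    exact hlim _

end CommonPayoff

section TwoActions

variable {I : Type*} [MeasurableSpace I] {A : Type*} [Fintype A]
  {lam : Measure I} {h : I → A → ℝ} {v : A → (A → ℝ) → ℝ} {a b : A}

theorem sum_eq_add_of_forall_eq_or (hab : a ≠ b) (hall : ∀ p, p = a ∨ p = b) (f : A → ℝ) :
    ∑ p, f p = f a + f b :=
  Fintype.sum_eq_add a b hab fun p hp => ((hall p).elim hp.1 hp.2).elim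

theorem IsNash.socSum_eq_zero (hab : a ≠ b) (hall : ∀ p, p = a ∨ p = b)
    (hn : IsNash lam (fun _ => v) h) (hlt : v a (socSum lam h) < v b (socSum lam h)) :
    socSum lam h a = 0 := by
  classical
  refine integral_eq_zero_of_ae ?_
  filter_upwards [hn.2] with i hi
  have hb := hi _ (single_mem_stdSimplex ℝ b)
  have hsum := (hn.1.2 i).2
  rw [sum_eq_add_of_forall_eq_or hab hall] at hsum
  rw [sum_eq_add_of_forall_eq_or hab hall, sum_eq_add_of_forall_eq_or hab hall] at hb
  simp only [Pi.single_eq_same, Pi.single_eq_of_ne hab, zero_mul, zero_add, one_mul] at hb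
  have hnonneg := (hn.1.2 i).1 a
  have hbeq : h i b = 1 - h i a := by linarith
  rw [hbeq] at hb
  have : h i a ≤ 0 := by
    by_contra hpos
    nlinarith [mul_pos (not_le.1 hpos) (sub_pos.2 hlt)]
  exact le_antisymm this hnonneg

/-- If one of two actions is always at least as good as the other, admissibility alone gives
robust perfection. -/
theorem isRPE_of_forall_le [IsProbabilityMeasure lam] (hab : a ≠ b)
    (hall : ∀ p, p = a ∨ p = b)
    (hv : ∀ c, ContinuousOn (v c) (stdSimplex ℝ A)) (hh : IsProfile lam h)
    (hadm : Admissible lam (fun _ => v) h) (hle : ∀ τ ∈ stdSimplex ℝ A, v a τ ≤ v b τ) :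
    IsRPE lam (fun _ => v) h := by
  classical
  have : Nonempty A := ⟨a⟩
  obtain ⟨η, hη⟩ := exists_fullSupportOnSimplex (A := A)
  have hq : (fun _ : A => (1 / 2 : ℝ)) ∈ stdSimplex ℝ A := by
    refine ⟨fun _ => by norm_num, ?_⟩
    rw [sum_eq_add_of_forall_eq_or hab hall]
    norm_num
  refine isRPE_of_mix hh v hη hq (fun _ => by norm_num) fun ε h0 h1 am al hlt => ?_
  have hfull := hη.pertOf h0 h1.le (convex_stdSimplex ℝ A hh.socSum_mem hq
    (sub_nonneg.2 h1.le) h0.le (by ring))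
  rcases hall am with rfl | rfl
  · rcases hall al with rfl | rfl
    · exact absurd hlt (lt_irrefl _)
    have hdom : WeaklyDominated v am := by
      by_contra hdom
      refine hlt.not_ge (hfull.payM_le hv fun τ hτ => not_lt.1 fun hτlt => hdom ?_)
      refine ⟨_, single_mem_stdSimplex ℝ al, fun σ hσ => ?_, τ, hτ, ?_⟩ <;>
        simp only [Pi.single_apply, ite_mul, one_mul, zero_mul, Finset.sum_ite_eq',
          Finset.mem_univ, if_true]
      exacts [hle σ hσ, hτlt]
    exact hadm.mono fun i hi => hi am hdom
  · rcases hall al with rfl | rfl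
    · exact absurd hlt (hfull.payM_le hv hle).not_gt
    · exact absurd hlt (lt_irrefl _)

/-- With two actions whose payoff difference is monotone in the summary, admissible equilibria
are robust perfect. -/
theorem isRPE_of_monotone [IsProbabilityMeasure lam] (hab : a ≠ b)
    (hall : ∀ p, p = a ∨ p = b)
    (hv : ∀ c, ContinuousOn (v c) (stdSimplex ℝ A))
    (hmono : ∀ σ ∈ stdSimplex ℝ A, ∀ τ ∈ stdSimplex ℝ A, σ a ≤ τ a →
      v a τ - v b τ ≤ v a σ - v b σ)
    (hn : IsNash lam (fun _ => v) h) (hadm : Admissible lam (fun _ => v) h) :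
    IsRPE lam (fun _ => v) h := by
  by_cases hle : ∀ τ ∈ stdSimplex ℝ A, v a τ ≤ v b τ
  · exact isRPE_of_forall_le hab hall hv hn.1 hadm hle
  by_cases hge : ∀ τ ∈ stdSimplex ℝ A, v b τ ≤ v a τ
  · exact isRPE_of_forall_le hab.symm (fun p => (hall p).symm) hv hn.1 hadm hge
  push Not at hle hge
  obtain ⟨y, hy, hylt⟩ := hle
  obtain ⟨x, hx, hxlt⟩ := hge
  have hs := hn.1.socSum_mem
  have hsum : ∀ τ ∈ stdSimplex ℝ A, τ a + τ b = 1 := fun τ hτ => by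
    rw [← sum_eq_add_of_forall_eq_or hab hall, hτ.2]
  have ha := fun h0 : socSum lam h a = 0 => hmono _ hs y hy (h0 ▸ hy.1 a)
  have hb := fun h0 : socSum lam h b = 0 => hmono x hx _ hs (by
    linarith [hsum _ hs, hsum x hx, hx.1 b])
  have heq : v a (socSum lam h) = v b (socSum lam h) := by
    rcases lt_trichotomy (v a (socSum lam h)) (v b (socSum lam h)) with hlt | heq | hgt
    · linarith [ha (hn.socSum_eq_zero hab hall hlt)]
    · exact heq
    · linarith [hb (hn.socSum_eq_zero hab.symm (fun p => (hall p).symm) hgt)]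
  have hpos : ∀ c, 0 < socSum lam h c := fun c => by
    refine lt_of_le_of_ne (hs.1 c) fun h0 => ?_
    rcases hall c with rfl | rfl
    · linarith [ha h0.symm]
    · linarith [hb h0.symm]
  have hD : ContinuousOn (fun τ => v a τ - v b τ) (stdSimplex ℝ A) := (hv a).sub (hv b)
  obtain ⟨η, hη, hη0⟩ := exists_fullSupportOnSimplex_integral_eq_zero hD hx hy
    (sub_neg.2 hxlt) (sub_pos.2 hylt)
  refine isRPE_of_mix hn.1 v hη hs hpos fun ε h0 h1 am al hlt => ?_
  have hmix : (1 - ε) • socSum lam h + ε • socSum lam h = socSum lam h := by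
    rw [← add_smul, sub_add_cancel, one_smul]
  rw [hmix] at hlt
  have hpay : payM v a (pertOf ε η (socSum lam h)) = payM v b (pertOf ε η (socSum lam h)) := by
    have hfull := hη.pertOf h0 h1.le hs
    rw [← sub_eq_zero, payM, payM, ← integral_sub (hfull.integrable (hv a))
      (hfull.integrable (hv b)), hη.integral_pertOf hD h0.le h1.le, hη0, heq]
    ring
  rcases hall am with rfl | rfl <;> rcases hall al with rfl | rfl <;>
    simp [hpay] at hlt

end TwoActions

section PathCost

variable {E P : Type*} [Fintype P] [DecidableEq E] {edgeOf : P → Finset E}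
  {C : E → ℝ → ℝ}

theorem edgeLoad_mem_Icc {τ : P → ℝ} (hτ : τ ∈ stdSimplex ℝ P) (e : E) :
    edgeLoad edgeOf τ e ∈ Set.Icc (0 : ℝ) 1 := by
  refine ⟨Finset.sum_nonneg fun p _ => ?_, hτ.2 ▸ Finset.sum_le_sum fun p _ => ?_⟩ <;>
    split_ifs <;> simp [hτ.1 p]

theorem continuousOn_pathCost (hC : IsCongestionCost C) (p : P) :
    ContinuousOn (pathCost edgeOf C p) (stdSimplex ℝ P) := by
  refine continuousOn_finsetSum _ fun e _ =>
    (hC e).1.comp (Continuous.continuousOn ?_) fun τ hτ => edgeLoad_mem_Icc hτ e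
  refine continuous_finsetSum _ fun q _ => ?_
  split_ifs
  exacts [continuous_apply q, continuous_const]

theorem pathCost_sub_le_pathCost_sub [Fintype E] (hC : IsCongestionCost C) {a b : P} (hab : a ≠ b)
    (hall : ∀ p, p = a ∨ p = b) {σ τ : P → ℝ} (hσ : σ ∈ stdSimplex ℝ P)
    (hτ : τ ∈ stdSimplex ℝ P) (hle : σ a ≤ τ a) :
    pathCost edgeOf C a σ - pathCost edgeOf C b σ ≤
      pathCost edgeOf C a τ - pathCost edgeOf C b τ := by
  have hcost : ∀ p ρ, pathCost edgeOf C p ρ =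
      ∑ e, if e ∈ edgeOf p then C e (edgeLoad edgeOf ρ e) else 0 := fun p ρ => by
    simp [pathCost]
  have hload : ∀ ρ e, edgeLoad edgeOf ρ e =
      (if e ∈ edgeOf a then ρ a else 0) + if e ∈ edgeOf b then ρ b else 0 := fun ρ e =>
    sum_eq_add_of_forall_eq_or hab hall _
  have hsumσ := (sum_eq_add_of_forall_eq_or hab hall σ).symm.trans hσ.2
  have hsumτ := (sum_eq_add_of_forall_eq_or hab hall τ).symm.trans hτ.2
  simp only [hcost]
  rw [← Finset.sum_sub_distrib, ← Finset.sum_sub_distrib]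
  refine Finset.sum_le_sum fun e _ => ?_
  by_cases ha : e ∈ edgeOf a <;> by_cases hb : e ∈ edgeOf b
  · simp [ha, hb]
  · have := (hC e).2.1 (edgeLoad_mem_Icc (edgeOf := edgeOf) hσ e)
      (edgeLoad_mem_Icc (edgeOf := edgeOf) hτ e)
      (by simpa [hload, ha, hb] using hle)
    simpa [ha, hb] using this
  · have := (hC e).2.1 (edgeLoad_mem_Icc (edgeOf := edgeOf) hτ e)
      (edgeLoad_mem_Icc (edgeOf := edgeOf) hσ e)
      (by simp only [hload, ha, hb, if_true, if_false]; linarith)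
    simpa [ha, hb] using this
  · simp [ha, hb]

end PathCost

/-- In any atomless congestion game with exactly two paths,
every admissible randomized strategy Nash equilibrium is a randomized strategy
robust perfect equilibrium. -/
theorem statement11 {I : Type*} [MeasurableSpace I]
    {E P : Type*} [Fintype E] [Fintype P] [DecidableEq E]
    (hcard : Fintype.card P = 2)
    (lam : Measure I) [IsProbabilityMeasure lam] (hatomless : MeasAtomless lam)
    (edgeOf : P → Finset E) (hedge : ∀ p, (edgeOf p).Nonempty)
    (C : E → ℝ → ℝ) (hC : IsCongestionCost C)
    (h : I → P → ℝ)
    (hnash : IsNash lam (congPayoff I edgeOf C) h)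
    (hadm : Admissible lam (congPayoff I edgeOf C) h) :
    IsRPE lam (congPayoff I edgeOf C) h := by
  classical
  obtain ⟨a, b, hab, huniv⟩ := Finset.card_eq_two.1 (Finset.card_univ.trans hcard)
  have hall : ∀ p : P, p = a ∨ p = b := fun p => by
    simpa [huniv] using Finset.mem_univ p
  refine isRPE_of_monotone hab hall (fun c => (continuousOn_pathCost hC c).neg)
    (fun σ hσ τ hτ hle => ?_) hnash hadm
  linarith [pathCost_sub_le_pathCost_sub (edgeOf := edgeOf) hC hab hall hσ hτ hle]
end

section
/- Fix parameters θ₁, θ₂ with 1 > θ₁ > θ₂ > 0 and consider the large game with action set A = {a, b, c} in which every player i ∈ I has the common payoff u(a, τ) = θ₁(τ(a) − 1/2), u(b, τ) = θ₂(τ(b) − 1/2), u(c, τ) = 0. Then the constant randomized strategy profile h⁰ with h⁰(i) = (1/2, 1/2, 0) for every i is an admissible randomized strategy Nash equilibrium, but h⁰ is not aggregate robust. -/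
open MeasureTheory Filter Topology

/-- A measure with full support on the simplex gives every coordinate a positive,
finite mean. -/
lemma FullSupportOnSimplex.integral_coord_pos {A : Type*} [Fintype A] {η : Measure (A → ℝ)}
    (hη : FullSupportOnSimplex η) (a : A) :
    Integrable (fun τ : A → ℝ => τ a) η ∧ 0 < ∫ τ, τ a ∂η := by
  classical
  obtain ⟨hprob, hcompl, hsupp⟩ := hη
  have hmem : ∀ᵐ τ ∂η, τ ∈ stdSimplex ℝ A := hcompl
  have hint : Integrable (fun τ : A → ℝ => τ a) η := by
    refine Integrable.of_bound (measurable_pi_apply a).aestronglyMeasurable 1 ?_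
    filter_upwards [hmem] with τ hτ
    have h1 : τ a ≤ ∑ b, τ b := Finset.single_le_sum (fun b _ => hτ.1 b) (Finset.mem_univ a)
    rw [Real.norm_eq_abs, abs_of_nonneg (hτ.1 a)]
    exact h1.trans hτ.2.le
  refine ⟨hint, ?_⟩
  have hnonneg : 0 ≤ᵐ[η] fun τ : A → ℝ => τ a := by
    filter_upwards [hmem] with τ hτ using hτ.1 a
  rw [integral_pos_iff_support_of_nonneg_ae hnonneg hint]
  refine hsupp _ (isOpen_ne_fun (continuous_apply a) continuous_const) ⟨Pi.single a 1, ?_, ?_⟩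
  · simp
  · exact single_mem_stdSimplex ℝ a

/-- Under a full-support measure on the simplex, the first two of three coordinates
have means summing to less than one. -/
lemma FullSupportOnSimplex.integral_add_lt_one {η : Measure (Fin 3 → ℝ)}
    (hη : FullSupportOnSimplex η) : ∫ τ, τ 0 ∂η + ∫ τ, τ 1 ∂η < 1 := by
  obtain ⟨i0, -⟩ := hη.integral_coord_pos 0
  obtain ⟨i1, -⟩ := hη.integral_coord_pos 1
  obtain ⟨i2, p2⟩ := hη.integral_coord_pos 2
  obtain ⟨hprob, hcompl, -⟩ := hη
  have hmem : ∀ᵐ τ ∂η, τ ∈ stdSimplex ℝ (Fin 3) := hcompl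
  have hsum : ∫ τ, (τ 0 + τ 1 + τ 2) ∂η = ∫ _, (1 : ℝ) ∂η := by
    refine integral_congr_ae ?_
    filter_upwards [hmem] with τ hτ
    rw [← hτ.2, Fin.sum_univ_three]
  have hi : Integrable (fun τ : Fin 3 → ℝ => τ 0 + τ 1) η := i0.add i1
  rw [integral_add hi i2, integral_add i0 i1] at hsum
  simp only [integral_const, probReal_univ, smul_eq_mul, mul_one] at hsum
  linarith

/-- In the attack game with payoffs
`u(a,τ) = θ₁(τ(a) - 1/2)`, `u(b,τ) = θ₂(τ(b) - 1/2)`, `u(c,τ) = 0`, where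
`1 > θ₁ > θ₂ > 0`, the constant profile `(1/2, 1/2, 0)` is an admissible Nash
equilibrium that is not aggregate robust. -/
theorem statement15 {I : Type*} [MeasurableSpace I]
    (lam : Measure I) [IsProbabilityMeasure lam] (hatomless : MeasAtomless lam)
    (θ1 θ2 : ℝ) (hθ1 : θ1 < 1) (hθ12 : θ2 < θ1) (hθ2 : 0 < θ2)
    (u : I → Fin 3 → (Fin 3 → ℝ) → ℝ)
    (hu : u = fun _ a τ =>
      if a = 0 then θ1 * (τ 0 - 1/2) else if a = 1 then θ2 * (τ 1 - 1/2) else 0)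
    (h0 : I → Fin 3 → ℝ) (hh0 : h0 = fun _ => ![1/2, 1/2, 0]) :
    IsNash lam u h0 ∧ Admissible lam u h0 ∧ ¬ AggregateRobust lam u h0 := by
  subst hu hh0
  have hs : socSum lam (fun _ : I => (![1/2, 1/2, 0] : Fin 3 → ℝ)) = ![1/2, 1/2, 0] := by
    funext a
    simp [socSum]
  have hmem : (![1/2, 1/2, 0] : Fin 3 → ℝ) ∈ stdSimplex ℝ (Fin 3) := by
    refine ⟨fun a => ?_, ?_⟩
    · fin_cases a <;> simp
    · rw [Fin.sum_univ_three]
      change (1 / 2 : ℝ) + 1 / 2 + 0 = 1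
      norm_num
  refine ⟨⟨⟨measurable_const, fun _ => hmem⟩, ?_⟩, ?_, ?_⟩
  · refine Eventually.of_forall fun _ μ _ => ?_
    rw [hs]
    simp
  · refine Eventually.of_forall fun _ a => ?_
    rintro ⟨μ, ⟨hμ0, hμ1⟩, hle, τ, -, hlt⟩
    rw [Fin.sum_univ_three] at hμ1
    have n0 := hμ0 0
    have n1 := hμ0 1
    have n2 := hμ0 2
    fin_cases a
    · exfalso
      have h := hle _ (single_mem_stdSimplex ℝ 0)
      simp [Fin.sum_univ_three] at h hlt
      have e0 : μ 0 = 1 := by nlinarith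
      have e1 : μ 1 = 0 := by linarith
      simp [e0, e1] at hlt
    · exfalso
      have h := hle _ (single_mem_stdSimplex ℝ 1)
      simp [Fin.sum_univ_three] at h hlt
      have e1 : μ 1 = 1 := by nlinarith
      have e0 : μ 0 = 0 := by linarith
      simp [e0, e1] at hlt
    · rfl
  · intro hrob
    obtain ⟨_, φ, hφ, -, hopt⟩ := hrob.exists
    rw [hs] at hopt
    have hη := (hφ 0).1 _ hmem
    replace hopt := hopt 0
    generalize φ 0 ![1/2, 1/2, 0] = η at hη hopt
    have hlt := hη.integral_add_lt_one
    obtain ⟨i0, -⟩ := hη.integral_coord_pos 0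
    obtain ⟨i1, -⟩ := hη.integral_coord_pos 1
    have := hη.1
    have h0 := hopt _ (single_mem_stdSimplex ℝ 0)
    have h1 := hopt _ (single_mem_stdSimplex ℝ 1)
    have h2 := hopt _ (single_mem_stdSimplex ℝ 2)
    simp only [payM, Fin.sum_univ_three, Pi.single_apply] at h0 h1 h2
    have e0 : ∫ τ, (τ 0 - 2⁻¹) ∂η = ∫ τ, τ 0 ∂η - 2⁻¹ := by
      simp [integral_sub i0 (integrable_const _)]
    have e1 : ∫ τ, (τ 1 - 2⁻¹) ∂η = ∫ τ, τ 1 ∂η - 2⁻¹ := by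
      simp [integral_sub i1 (integrable_const _)]
    simp [integral_const_mul, e0, e1] at h0 h1 h2
    have p0 : 0 ≤ ∫ τ, τ 0 ∂η - 2⁻¹ := by
      refine nonneg_of_mul_nonneg_right (a := θ1) ?_ (hθ2.trans hθ12)
      linarith
    have p1 : 0 ≤ ∫ τ, τ 1 ∂η - 2⁻¹ := by
      refine nonneg_of_mul_nonneg_right (a := θ2) ?_ hθ2
      linarith
    linarith
end

section
/- In the three-path game, for τ ∈ Δ the following are equivalent: (i) there exists a randomized strategy Nash equilibrium h with ∫_I h(i) dλ(i) = τ; (ii) τ(c) = 1/6 and τ(b) ≤ 1/2. Consequently, the Nash equilibrium traffic flows are exactly the distributions (5/6 − t, t, 1/6) with t ∈ [0, 1/2]. -/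
open MeasureTheory Filter Topology

/-- The common payoff of the three-path game. -/
noncomputable def threePath : Fin 3 → (Fin 3 → ℝ) → ℝ := fun a τ =>
  if a = 0 then -(1/2) else if a = 1 then -(max (τ 1) (1/2)) else -(τ 2) - 1/3

/-- When all players share the payoff `u`, a distribution `τ` in the simplex is a Nash equilibrium
summary iff `τ` is itself a best response to `τ`. -/
theorem exists_isNash_socSum_eq_iff {I : Type*} [MeasurableSpace I] {A : Type*} [Fintype A]
    (lam : Measure I) [IsProbabilityMeasure lam] (u : A → (A → ℝ) → ℝ)
    {τ : A → ℝ} (hτ : τ ∈ stdSimplex ℝ A) :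
    (∃ h : I → A → ℝ, IsNash lam (fun _ => u) h ∧ socSum lam h = τ) ↔
      ∀ μ ∈ stdSimplex ℝ A, ∑ a, μ a * u a τ ≤ ∑ a, τ a * u a τ := by
  constructor
  · rintro ⟨h, ⟨⟨hmeas, hmem⟩, hopt⟩, rfl⟩ μ hμ
    have hint : ∀ a, Integrable (fun i => h i a) lam := fun a =>
      Integrable.of_bound ((measurable_pi_apply a).comp hmeas).aestronglyMeasurable 1
        (Eventually.of_forall fun i => by
          rw [Real.norm_eq_abs, abs_of_nonneg ((hmem i).1 a), ← (hmem i).2]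
          exact Finset.single_le_sum (fun b _ => (hmem i).1 b) (Finset.mem_univ a))
    have hmono := integral_mono_ae (integrable_const (∑ a, μ a * u a (socSum lam h)))
      (integrable_finsetSum Finset.univ fun a _ => (hint a).mul_const (u a (socSum lam h)))
      (hopt.mono fun i hi => hi μ hμ)
    rw [integral_const, integral_finsetSum _ fun a _ => (hint a).mul_const _] at hmono
    simp only [integral_mul_const, probReal_univ, one_smul] at hmono
    exact hmono
  · intro hbest
    have hsum : socSum lam (fun _ => τ) = τ := by
      funext a
      simp [socSum]
    refine ⟨fun _ => τ, ⟨⟨measurable_const, fun _ => hτ⟩, ?_⟩, hsum⟩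
    rw [hsum]
    exact Eventually.of_forall fun _ => hbest

/-- In the three-path game, the distributions that are best responses to themselves are those with
`τ(c) = 1/6` and `τ(b) ≤ 1/2`. -/
theorem threePath_bestResponse_iff {τ : Fin 3 → ℝ} (hτ : τ ∈ stdSimplex ℝ (Fin 3)) :
    (∀ μ ∈ stdSimplex ℝ (Fin 3), ∑ a, μ a * threePath a τ ≤ ∑ a, τ a * threePath a τ) ↔
      τ 2 = 1/6 ∧ τ 1 ≤ 1/2 := by
  have h0 := hτ.1 0
  have h1 := hτ.1 1
  have h2 := hτ.1 2
  have hs := hτ.2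
  simp only [Fin.sum_univ_three] at hs
  simp only [Fin.sum_univ_three, threePath, Fin.isValue, if_true, one_ne_zero, if_false,
    show (2 : Fin 3) ≠ 0 by decide, show (2 : Fin 3) ≠ 1 by decide]
  constructor
  · intro hbest
    have ha := hbest _ (single_mem_stdSimplex ℝ 0)
    have hc := hbest _ (single_mem_stdSimplex ℝ 2)
    have hm1 := le_max_left (τ 1) (1/2)
    have hm2 := le_max_right (τ 1) (1/2)
    generalize max (τ 1) (1/2) = m at ha hc hm1 hm2
    simp at ha hc
    have hle : τ 2 ≤ 1/6 := by
      by_contra! hlt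
      nlinarith [mul_le_mul_of_nonneg_left hm2 h1]
    have hge : 1/6 ≤ τ 2 := by
      by_contra! hlt
      nlinarith [mul_le_mul_of_nonneg_left hm2 h1]
    have heq : τ 2 = 1/6 := le_antisymm hle hge
    refine ⟨heq, ?_⟩
    by_contra! hlt
    rw [heq] at ha
    nlinarith [mul_le_mul_of_nonneg_left hm1 h1]
  · rintro ⟨hc, hb⟩ μ hμ
    have hμs := hμ.2
    simp only [Fin.sum_univ_three] at hμs
    rw [max_eq_right hb, hc]
    linarith

/-- In the three-path game, a distribution `τ` in the simplex
is the societal summary of some randomized strategy Nash equilibrium iff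
`τ(c) = 1/6` and `τ(b) ≤ 1/2`; equivalently, iff `τ = (5/6 - t, t, 1/6)` for
some `t ∈ [0, 1/2]`. -/
theorem statement16 {I : Type*} [MeasurableSpace I]
    (lam : Measure I) [IsProbabilityMeasure lam] (hatomless : MeasAtomless lam)
    (τ : Fin 3 → ℝ) (hτ : τ ∈ stdSimplex ℝ (Fin 3)) :
    ((∃ h : I → Fin 3 → ℝ, IsNash lam (fun _ => threePath) h ∧ socSum lam h = τ) ↔
      (τ 2 = 1/6 ∧ τ 1 ≤ 1/2)) ∧
    ((∃ h : I → Fin 3 → ℝ, IsNash lam (fun _ => threePath) h ∧ socSum lam h = τ) ↔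
      (∃ t ∈ Set.Icc (0:ℝ) (1/2), τ = ![5/6 - t, t, 1/6])) := by
  have hiff := (exists_isNash_socSum_eq_iff lam threePath hτ).trans (threePath_bestResponse_iff hτ)
  refine ⟨hiff, hiff.trans ⟨?_, ?_⟩⟩
  · rintro ⟨hc, hb⟩
    have hs := hτ.2
    simp only [Fin.sum_univ_three] at hs
    refine ⟨τ 1, ⟨hτ.1 1, hb⟩, ?_⟩
    funext a
    fin_cases a
    · simp
      linarith
    · simp
    · simpa using hc
  · rintro ⟨t, ht, rfl⟩
    exact ⟨by simp, by simpa using ht.2⟩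
end

section
/- Let ε ∈ (0, 1/10) and let g : [0,1] → ℝ be continuous with g(x) > 1/2 for every x ∈ [0,1]. Then the function F(τ) = τ(a)/2 + ∫_0^{τ(b)} g(x) dx + (1 − ε)τ(c)²/2 + (1 + ε)τ(c)/3, defined on the constrained simplex {τ = (τ(a), τ(b), τ(c)) : τ(a), τ(b), τ(c) ≥ ε and τ(a) + τ(b) + τ(c) = 1}, attains its minimum at the unique point τ^ε = ((5 − 10ε + 6ε²)/(6 − 6ε), ε, (1 − 2ε)/(6 − 6ε)). -/
open MeasureTheory Filter Topology

/-- A continuous function that exceeds `m` on `[a, b]` has integral over a nondegenerate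
interval exceeding `m * (b - a)`. -/
theorem mul_sub_lt_intervalIntegral {g : ℝ → ℝ} {a b m : ℝ} (hab : a < b)
    (hg : ContinuousOn g (Set.Icc a b)) (hm : ∀ x ∈ Set.Icc a b, m < g x) :
    m * (b - a) < ∫ x in a..b, g x := by
  have h := intervalIntegral.integral_lt_integral_of_continuousOn_of_le_of_exists_lt hab
    (continuousOn_const (c := m)) hg (fun x hx => (hm x (Set.Ioc_subset_Icc_self hx)).le)
    ⟨a, Set.left_mem_Icc.2 hab.le, hm a (Set.left_mem_Icc.2 hab.le)⟩
  rw [intervalIntegral.integral_const, smul_eq_mul] at h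
  linarith

/-- For `ε ∈ (0, 1/10)` and any continuous `g : [0,1] → ℝ`
with `g > 1/2` on `[0,1]`, the objective
`F(τ) = τ(a)/2 + ∫_0^{τ(b)} g + (1-ε)τ(c)²/2 + (1+ε)τ(c)/3` on the constrained
simplex `{τ : τ(k) ≥ ε, Σ τ(k) = 1}` attains its minimum at the unique point
`τ^ε = ((5 - 10ε + 6ε²)/(6 - 6ε), ε, (1 - 2ε)/(6 - 6ε))`. -/
theorem statement18 (ε : ℝ) (hε : ε ∈ Set.Ioo (0:ℝ) (1/10))
    (g : ℝ → ℝ) (hg : ContinuousOn g (Set.Icc (0:ℝ) 1))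
    (hg2 : ∀ x ∈ Set.Icc (0:ℝ) 1, 1/2 < g x)
    (F : (Fin 3 → ℝ) → ℝ)
    (hF : F = fun τ =>
      τ 0 / 2 + (∫ x in (0:ℝ)..(τ 1), g x) + (1 - ε) * (τ 2)^2 / 2 + (1 + ε) * τ 2 / 3)
    (S : Set (Fin 3 → ℝ))
    (hS : S = {τ | (∀ k, ε ≤ τ k) ∧ τ 0 + τ 1 + τ 2 = 1})
    (τε : Fin 3 → ℝ)
    (hτε : τε = ![(5 - 10*ε + 6*ε^2)/(6 - 6*ε), ε, (1 - 2*ε)/(6 - 6*ε)]) :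
    τε ∈ S ∧ ∀ τ ∈ S, τ ≠ τε → F τε < F τ := by
  obtain ⟨hε0, hε1⟩ := hε
  have hden : 0 < 6 - 6 * ε := by linarith
  obtain ⟨c, hc⟩ : ∃ c, c = (1 - 2 * ε) / (6 - 6 * ε) := ⟨_, rfl⟩
  have hcmul : c * (6 - 6 * ε) = 1 - 2 * ε := by rw [hc, div_mul_cancel₀ _ hden.ne']
  have ha : (5 - 10 * ε + 6 * ε ^ 2) / (6 - 6 * ε) = 1 - ε - c := by
    rw [div_eq_iff hden.ne']
    linear_combination hcmul
  have hcε : ε ≤ c := by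
    rw [hc, le_div_iff₀ hden]
    nlinarith
  have hc1 : c ≤ 1 / 2 := by
    rw [hc, div_le_iff₀ hden]
    linarith
  rw [ha, ← hc] at hτε
  subst hτε hS hF
  refine ⟨⟨fun k => ?_, by simp; ring⟩, ?_⟩
  · fin_cases k
    · simp
      linarith
    · simp
    · simpa using hcε
  rintro τ ⟨hτ, hsum⟩ hne
  have h0 := hτ 0
  have h1 := hτ 1
  have h2 := hτ 2
  have hsplit : (∫ x in (0:ℝ)..ε, g x) + ∫ x in ε..(τ 1), g x = ∫ x in (0:ℝ)..(τ 1), g x := by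
    apply intervalIntegral.integral_add_adjacent_intervals
    · apply (hg.mono _).intervalIntegrable
      rw [Set.uIcc_of_le hε0.le]
      exact Set.Icc_subset_Icc le_rfl (by linarith)
    · apply (hg.mono _).intervalIntegrable
      rw [Set.uIcc_of_le h1]
      exact Set.Icc_subset_Icc hε0.le (by linarith)
  have hdiff : τ 0 / 2 + (∫ x in (0:ℝ)..(τ 1), g x) + (1 - ε) * (τ 2) ^ 2 / 2
      + (1 + ε) * τ 2 / 3 - ((1 - ε - c) / 2 + (∫ x in (0:ℝ)..ε, g x) + (1 - ε) * c ^ 2 / 2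
      + (1 + ε) * c / 3) =
      ((∫ x in ε..(τ 1), g x) - 1 / 2 * (τ 1 - ε)) + (1 - ε) / 2 * (τ 2 - c) ^ 2 := by
    linear_combination -hsplit + hsum / 2 + (τ 2 - c) / 6 * hcmul
  suffices h : 0 < ((∫ x in ε..(τ 1), g x) - 1 / 2 * (τ 1 - ε)) + (1 - ε) / 2 * (τ 2 - c) ^ 2 by
    simp only [Matrix.cons_val]
    linarith
  have hcoef : 0 < (1 - ε) / 2 := by linarith
  rcases h1.eq_or_lt with h | h
  · have hτc : τ 2 - c ≠ 0 := by
      intro h'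
      apply hne
      ext k
      fin_cases k <;> simp <;> linarith
    rw [← h]
    simpa using mul_pos hcoef (sq_pos_of_ne_zero hτc)
  · have hsub : Set.Icc ε (τ 1) ⊆ Set.Icc 0 1 := Set.Icc_subset_Icc hε0.le (by linarith)
    have := mul_sub_lt_intervalIntegral h (hg.mono hsub) fun x hx => hg2 x (hsub hx)
    have := mul_nonneg hcoef.le (sq_nonneg (τ 2 - c))
    linarith
end
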